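/- arXiv:math/0110316 — 2 statements merged into one kernel-verified Lean document; each statement's English description precedes it below -/
import Mathlib

section
/- Let C be a cocomplete category, let 0 ≤ i ≤ n, and let s_i : Δ[n+1] → Δ[n] be the i-th degeneracy map of standard simplices. Let g : K → Δ[n] be any map of simplicial sets, form the pullback P = K ×_{Δ[n]} Δ[n+1] in simplicial sets, and let p : P → K be the projection. If F : 𝐊 → C is a bounded diagram, then the induced morphism colim_𝐏 (F ∘ p) → colim_𝐊 F on colimits over the simplex categories is an isomorphism. -/
open CategoryTheory CategoryTheory.Limits Opposite Simplicial

universe w v u v₂ u₂ v₃ u₃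

/-- The simplex category `𝐊` of a simplicial set `K`: objects are the simplices of `K`
and a morphism `σ ⟶ τ` is a map `α : Δ[n] ⟶ Δ[m]` of standard simplices with
`τ ∘ α = σ`.  It is realized as the opposite of the category of elements of `K`. -/
abbrev SimplexCat (K : SSet.{0}) := K.Elementsᵒᵖ

/-- The functor `𝐋 ⥤ 𝐊` between simplex categories induced by a map `f : L ⟶ K` of
simplicial sets. -/
def simplexMap {L K : SSet.{0}} (f : L ⟶ K) :
    SimplexCat L ⥤ SimplexCat K :=
  (CategoryOfElements.map f).op

/-- A diagram `F : 𝐊 ⥤ C` indexed by the simplex category of a simplicial set is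
*bounded* if it sends every morphism of `𝐊` whose underlying map in the simplex
category `Δ` is surjective (in particular, every degeneracy morphism `s_iσ ⟶ σ`) to an
isomorphism of `C`. -/
def BoundedDiagram {C : Type u₂} [Category.{v₂} C] {K : SSet.{0}}
    (F : SimplexCat K ⥤ C) : Prop :=
  ∀ {x y : SimplexCat K} (e : x ⟶ y),
    Function.Surjective e.unop.val.unop.toOrderHom → IsIso (F.map e)


section SimplexAux

open SimplexCategory

/-- Two lifts of `φ` along `s` which are pointwise comparable are connected by elementary
moves, each being given by the two faces of a simplex over a degeneracy of `φ`. -/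
lemma lift_chain_aux {m N n : ℕ} (s : SimplexCategory.mk N ⟶ SimplexCategory.mk n)
    (φ : SimplexCategory.mk m ⟶ SimplexCategory.mk n) {T : Sort*}
    (Φ : {γ : SimplexCategory.mk m ⟶ SimplexCategory.mk N // γ ≫ s = φ} → T)
    (hΦ : ∀ (c : Fin (m + 1)) (β : SimplexCategory.mk (m + 1) ⟶ SimplexCategory.mk N)
      (_ : β ≫ s = SimplexCategory.σ c ≫ φ)
      (x y : {γ : SimplexCategory.mk m ⟶ SimplexCategory.mk N // γ ≫ s = φ}),
      SimplexCategory.δ c.castSucc ≫ β = x.1 → SimplexCategory.δ c.succ ≫ β = y.1 → Φ x = Φ y)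
    (a b : {γ : SimplexCategory.mk m ⟶ SimplexCategory.mk N // γ ≫ s = φ})
    (hab : ∀ k, a.1.toOrderHom k ≤ b.1.toOrderHom k) : Φ a = Φ b := by
  have ha : ∀ k, s.toOrderHom (a.1.toOrderHom k) = φ.toOrderHom k := fun k =>
    congrArg (fun f => SimplexCategory.Hom.toOrderHom f k) a.2
  have hb : ∀ k, s.toOrderHom (b.1.toOrderHom k) = φ.toOrderHom k := fun k =>
    congrArg (fun f => SimplexCategory.Hom.toOrderHom f k) b.2
  have ma := a.1.toOrderHom.monotone
  have mb := b.1.toOrderHom.monotone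
  let γ : ℕ → {γ : SimplexCategory.mk m ⟶ SimplexCategory.mk N // γ ≫ s = φ} := fun c =>
    ⟨SimplexCategory.Hom.mk
      { toFun := fun k => if k.val < c then a.1.toOrderHom k else b.1.toOrderHom k
        monotone' := by
          intro k l hkl
          have h' : k.val ≤ l.val := hkl
          dsimp only
          split_ifs
          · exact ma hkl
          · exact (hab k).trans (mb hkl)
          · omega
          · exact mb hkl }, by
      ext k : 3
      change s.toOrderHom (if k.val < c then a.1.toOrderHom k else b.1.toOrderHom k)
        = φ.toOrderHom k
      split_ifs
      · exact ha k
      · exact hb k⟩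
  have step : ∀ c : ℕ, c ≤ m → Φ (γ c) = Φ (γ (c + 1)) := by
    intro c hc
    let c' : Fin (m + 1) := ⟨c, by omega⟩
    let β : SimplexCategory.mk (m + 1) ⟶ SimplexCategory.mk N := SimplexCategory.Hom.mk
      { toFun := fun (k : Fin (m + 2)) => if k.val ≤ c then a.1.toOrderHom (c'.predAbove k)
          else b.1.toOrderHom (c'.predAbove k)
        monotone' := by
          intro k l hkl
          have h' : k.val ≤ l.val := hkl
          have hp : c'.predAbove k ≤ c'.predAbove l := Fin.predAbove_right_monotone _ hkl
          dsimp only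
          split_ifs
          · exact ma hp
          · exact (hab _).trans (mb hp)
          · omega
          · exact mb hp }
    refine hΦ c' β ?_ _ _ ?_ ?_
    · ext k : 3
      change s.toOrderHom (if k.val ≤ c then a.1.toOrderHom (c'.predAbove k)
          else b.1.toOrderHom (c'.predAbove k)) = φ.toOrderHom (c'.predAbove k)
      split_ifs
      · exact ha _
      · exact hb _
    · ext k : 3
      change (if (c'.castSucc.succAbove k).val ≤ c
          then a.1.toOrderHom (c'.predAbove (c'.castSucc.succAbove k))
          else b.1.toOrderHom (c'.predAbove (c'.castSucc.succAbove k))) =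
          if k.val < c then a.1.toOrderHom k else b.1.toOrderHom k
      have e1 : c'.predAbove (c'.castSucc.succAbove k) = k := by simp
      have e2 : (c'.castSucc.succAbove k).val ≤ c ↔ k.val < c := by
        simp only [Fin.succAbove, Fin.lt_def]
        split_ifs with h
        · have h' : k.val < c := h
          exact ⟨fun _ => h', fun _ => h'.le⟩
        · have h' : ¬ k.val < c := h
          rw [Fin.val_succ]
          omega
      rw [e1]
      simp only [e2]
    · ext k : 3
      change (if (c'.succ.succAbove k).val ≤ c
          then a.1.toOrderHom (c'.predAbove (c'.succ.succAbove k))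
          else b.1.toOrderHom (c'.predAbove (c'.succ.succAbove k))) =
          if k.val < c + 1 then a.1.toOrderHom k else b.1.toOrderHom k
      have e1 : c'.predAbove (c'.succ.succAbove k) = k :=
        congrArg (fun f => SimplexCategory.Hom.toOrderHom f k)
          (SimplexCategory.δ_comp_σ_succ (i := c'))
      have e2 : (c'.succ.succAbove k).val ≤ c ↔ k.val < c + 1 := by
        simp only [Fin.succAbove, Fin.lt_def]
        split_ifs with h
        · have h' : k.val < c + 1 := h
          exact ⟨fun _ => h', fun _ => by
            have : k.val ≤ c := by omega
            exact this⟩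
        · have h' : ¬ k.val < c + 1 := h
          rw [Fin.val_succ]
          omega
      rw [e1]
      simp only [e2]
  have all : ∀ c : ℕ, c ≤ m + 1 → Φ (γ 0) = Φ (γ c) := by
    intro c
    induction c with
    | zero => intro _; rfl
    | succ c ih => intro hc; exact (ih (by omega)).trans (step c (by omega))
  have e0 : γ 0 = b := by
    apply Subtype.ext
    ext k : 3
    change (if k.val < 0 then a.1.toOrderHom k else b.1.toOrderHom k) = _
    simp
  have e1 : γ (m + 1) = a := by
    apply Subtype.ext
    ext k : 3
    change (if k.val < m + 1 then a.1.toOrderHom k else b.1.toOrderHom k) = _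
    rw [if_pos k.isLt]
  rw [← e0, ← e1]
  exact (all (m + 1) le_rfl).symm

lemma succAbove_predAbove_le {n : ℕ} (i : Fin (n + 1)) (y : Fin (n + 2)) :
    i.succ.succAbove (i.predAbove y) ≤ y := by
  rcases le_or_gt y i.castSucc with h | h
  · rw [Fin.predAbove_of_le_castSucc _ _ h, Fin.succAbove_of_castSucc_lt]
    · simp
    · simpa using lt_of_le_of_lt h Fin.castSucc_lt_succ
  · rw [Fin.predAbove_of_castSucc_lt _ _ h]
    have h' : i.val < y.val := h
    simp only [Fin.succAbove, Fin.lt_def, Fin.le_def]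
    split_ifs with h1 <;> simp at h1 ⊢

/-- Any two lifts of `φ` along `σ i` are connected by elementary moves. -/
lemma lift_chain {m n : ℕ} (i : Fin (n + 1))
    (φ : SimplexCategory.mk m ⟶ SimplexCategory.mk n) {T : Sort*}
    (Φ : {γ : SimplexCategory.mk m ⟶ SimplexCategory.mk (n + 1) // γ ≫ SimplexCategory.σ i = φ} → T)
    (hΦ : ∀ (c : Fin (m + 1)) (β : SimplexCategory.mk (m + 1) ⟶ SimplexCategory.mk (n + 1))
      (_ : β ≫ SimplexCategory.σ i = SimplexCategory.σ c ≫ φ)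
      (x y : {γ : SimplexCategory.mk m ⟶ SimplexCategory.mk (n + 1) //
        γ ≫ SimplexCategory.σ i = φ}),
      SimplexCategory.δ c.castSucc ≫ β = x.1 → SimplexCategory.δ c.succ ≫ β = y.1 → Φ x = Φ y)
    (a b : {γ : SimplexCategory.mk m ⟶ SimplexCategory.mk (n + 1) //
      γ ≫ SimplexCategory.σ i = φ}) : Φ a = Φ b := by
  let z : {γ : SimplexCategory.mk m ⟶ SimplexCategory.mk (n + 1) //
      γ ≫ SimplexCategory.σ i = φ} :=
    ⟨φ ≫ SimplexCategory.δ i.succ, by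
      rw [Category.assoc, SimplexCategory.δ_comp_σ_succ, Category.comp_id]⟩
  have key : ∀ x, Φ z = Φ x := by
    intro x
    apply lift_chain_aux _ _ Φ hΦ
    intro k
    have hx : φ.toOrderHom k = i.predAbove (x.1.toOrderHom k) :=
      (congrArg (fun f => SimplexCategory.Hom.toOrderHom f k) x.2).symm
    change i.succ.succAbove (φ.toOrderHom k) ≤ x.1.toOrderHom k
    rw [hx]
    exact succAbove_predAbove_le i _
  rw [← key a, ← key b]

end SimplexAux

section LegAux

variable {C : Type u₂} [Category.{v₂} C]

/-- The object of the simplex category given by a simplex. -/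
abbrev simplexObj (K : SSet.{0}) {m : SimplexCategory} (x : K.obj (op m)) : SimplexCat K :=
  op (K.elementsMk (op m) x)

/-- Constructor for morphisms in the simplex category. -/
abbrev simplexHom (K : SSet.{0}) {m m' : SimplexCategory} (f : m ⟶ m') (x : K.obj (op m))
    (y : K.obj (op m')) (h : K.map f.op y = x) : simplexObj K x ⟶ simplexObj K y :=
  Quiver.Hom.op (X := K.elementsMk (op m') y) (Y := K.elementsMk (op m) x) ⟨f.op, h⟩

lemma simplexCat_hom_ext {K : SSet.{0}} {x y : SimplexCat K} (f g : x ⟶ y)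
    (h : f.unop.val = g.unop.val) : f = g :=
  Quiver.Hom.unop_inj (Subtype.ext h)

variable {P K : SSet.{0}} (p : P ⟶ K) (F : SimplexCat K ⥤ C)
  (c : Cocone (simplexMap p ⋙ F))

/-- The component of the cocone at a simplex `x`. -/
def legι {m : SimplexCategory} (x : P.obj (op m)) :
    F.obj (simplexObj K (p.app _ x)) ⟶ c.pt :=
  c.ι.app (simplexObj P x)

lemma legι_w {m m' : SimplexCategory} (f : m ⟶ m') (x : P.obj (op m)) (y : P.obj (op m'))
    (hxy : P.map f.op y = x) (h : K.map f.op (p.app _ y) = p.app _ x) :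
    F.map (simplexHom K f (p.app _ x) (p.app _ y) h) ≫ legι p F c y = legι p F c x :=
  c.w (simplexHom P f x y hxy)

/-- The map from `F σ` to the cocone point given by a lift `x` of `σ`. -/
def leg {m : SimplexCategory} (σ : K.obj (op m)) (x : P.obj (op m)) (h : p.app _ x = σ) :
    F.obj (simplexObj K σ) ⟶ c.pt :=
  F.map (simplexHom K (𝟙 m) σ (p.app _ x) (by simpa using h)) ≫ legι p F c x

lemma leg_nat {m m' : SimplexCategory} (f : m ⟶ m') (σ : K.obj (op m)) (τ : K.obj (op m'))
    (hf : K.map f.op τ = σ) (x : P.obj (op m)) (y : P.obj (op m'))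
    (hxy : P.map f.op y = x) (hx : p.app _ x = σ) (hy : p.app _ y = τ) :
    F.map (simplexHom K f σ τ hf) ≫ leg p F c τ y hy = leg p F c σ x hx := by
  unfold leg
  rw [← legι_w p F c f x y hxy (by rw [hx, hy, hf])]
  rw [← Category.assoc, ← Category.assoc, ← F.map_comp, ← F.map_comp]
  congr 2

lemma leg_step (hF : BoundedDiagram F) {m : ℕ} (j : Fin (m + 1))
    (σ : K.obj (op (SimplexCategory.mk m)))
    (w : P.obj (op (SimplexCategory.mk (m + 1))))
    (hw : p.app _ w = K.map (SimplexCategory.σ j).op σ)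
    (x y : P.obj (op (SimplexCategory.mk m))) (hx : p.app _ x = σ) (hy : p.app _ y = σ)
    (hwx : P.map (SimplexCategory.δ j.castSucc).op w = x)
    (hwy : P.map (SimplexCategory.δ j.succ).op w = y) :
    leg p F c σ x hx = leg p F c σ y hy := by
  have h1 : K.map (SimplexCategory.δ j.castSucc).op (K.map (SimplexCategory.σ j).op σ) = σ := by
    rw [← hw, ← hx, ← hwx]
    exact (NatTrans.naturality_apply p _ _).symm
  have h2 : K.map (SimplexCategory.δ j.succ).op (K.map (SimplexCategory.σ j).op σ) = σ := by
    rw [← hw, ← hy, ← hwy]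
    exact (NatTrans.naturality_apply p _ _).symm
  rw [← leg_nat p F c (SimplexCategory.δ j.castSucc) σ _ h1 x w hwx hx hw,
    ← leg_nat p F c (SimplexCategory.δ j.succ) σ _ h2 y w hwy hy hw]
  congr 1
  have : IsIso (F.map (simplexHom K (SimplexCategory.σ j) _ σ rfl)) := by
    apply hF
    change Function.Surjective j.predAbove
    exact fun k => ⟨j.castSucc.succAbove k, by simp⟩
  rw [← cancel_mono (F.map (simplexHom K (SimplexCategory.σ j) _ σ rfl)),
    ← F.map_comp, ← F.map_comp]
  congr 1
  apply simplexCat_hom_ext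
  change (SimplexCategory.σ j).op ≫ (SimplexCategory.δ j.castSucc).op =
    (SimplexCategory.σ j).op ≫ (SimplexCategory.δ j.succ).op
  rw [← op_comp, ← op_comp, SimplexCategory.δ_comp_σ_self, SimplexCategory.δ_comp_σ_succ]

variable {n : ℕ} (i : Fin (n + 1)) {g : K ⟶ SSet.stdSimplex.obj (SimplexCategory.mk n)}
  {q : P ⟶ SSet.stdSimplex.obj (SimplexCategory.mk (n + 1))}

lemma pullback_exists
    (sq : IsPullback p q g (SSet.stdSimplex.map (SimplexCategory.σ i)))
    {m : SimplexCategory} (σ : K.obj (op m)) (γ : m ⟶ SimplexCategory.mk (n + 1))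
    (h : γ ≫ SimplexCategory.σ i = SSet.stdSimplex.objEquiv (g.app _ σ)) :
    ∃ x : P.obj (op m), p.app _ x = σ ∧ SSet.stdSimplex.objEquiv (q.app _ x) = γ := by
  obtain ⟨x, h1, h2⟩ := Types.exists_of_isPullback (sq.map ((evaluation _ _).obj (op m))) σ
    (SSet.stdSimplex.objEquiv.symm γ) (by
      apply SSet.stdSimplex.objEquiv.injective
      exact h.symm)
  refine ⟨x, h1, ?_⟩
  rw [← Equiv.eq_symm_apply]
  exact h2

lemma pullback_ext
    (sq : IsPullback p q g (SSet.stdSimplex.map (SimplexCategory.σ i)))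
    {m : SimplexCategory} (x y : P.obj (op m)) (h1 : p.app _ x = p.app _ y)
    (h2 : SSet.stdSimplex.objEquiv (q.app _ x) = SSet.stdSimplex.objEquiv (q.app _ y)) : x = y :=
  Types.ext_of_isPullback (sq.map ((evaluation _ _).obj (op m))) h1
    (SSet.stdSimplex.objEquiv.injective h2)

lemma pullback_w
    (sq : IsPullback p q g (SSet.stdSimplex.map (SimplexCategory.σ i)))
    {m : SimplexCategory} (x : P.obj (op m)) :
    SSet.stdSimplex.objEquiv (q.app _ x) ≫ SimplexCategory.σ i =
      SSet.stdSimplex.objEquiv (g.app _ (p.app _ x)) := by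
  have := ConcreteCategory.congr_hom (NatTrans.congr_app sq.w (op m)) x
  exact (congrArg SSet.stdSimplex.objEquiv this).symm

lemma objEquiv_nat {X : SSet.{0}} {N : SimplexCategory} (q : X ⟶ SSet.stdSimplex.obj N)
    {m m' : SimplexCategory} (f : m ⟶ m') (x : X.obj (op m')) :
    SSet.stdSimplex.objEquiv (q.app _ (X.map f.op x)) =
      f ≫ SSet.stdSimplex.objEquiv (q.app _ x) := by
  rw [NatTrans.naturality_apply q]
  rfl

lemma leg_indep (hF : BoundedDiagram F)
    (sq : IsPullback p q g (SSet.stdSimplex.map (SimplexCategory.σ i)))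
    {m : ℕ} (σ : K.obj (op (SimplexCategory.mk m)))
    (x y : P.obj (op (SimplexCategory.mk m))) (hx : p.app _ x = σ) (hy : p.app _ y = σ) :
    leg p F c σ x hx = leg p F c σ y hy := by
  choose l hl1 hl2 using fun (γ : {γ : SimplexCategory.mk m ⟶ SimplexCategory.mk (n + 1) //
    γ ≫ SimplexCategory.σ i = SSet.stdSimplex.objEquiv (g.app _ σ)}) =>
      pullback_exists p i sq σ γ.1 γ.2
  have key := lift_chain i (SSet.stdSimplex.objEquiv (g.app _ σ))
    (fun γ => leg p F c σ (l γ) (hl1 γ)) (by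
      intro j β hβ a b ha hb
      obtain ⟨w, hw1, hw2⟩ := pullback_exists p i sq
        (K.map (SimplexCategory.σ j).op σ) β (by rw [hβ, objEquiv_nat])
      have hK : ∀ (f : SimplexCategory.mk m ⟶ SimplexCategory.mk (m + 1))
          (_ : f ≫ SimplexCategory.σ j = 𝟙 _), p.app _ (P.map f.op w) = σ := by
        intro f hf
        rw [NatTrans.naturality_apply p, hw1, ← Functor.map_comp_apply, ← op_comp, hf]
        simp
      refine leg_step p F c hF j σ w hw1 _ _ _ _ ?_ ?_
      · apply pullback_ext p i sq
        · rw [hl1, hK _ (SimplexCategory.δ_comp_σ_self)]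
        · rw [hl2, objEquiv_nat, hw2, ha]
      · apply pullback_ext p i sq
        · rw [hl1, hK _ (SimplexCategory.δ_comp_σ_succ)]
        · rw [hl2, objEquiv_nat, hw2, hb])
  have e : ∀ (z : P.obj (op (SimplexCategory.mk m))) (hz : p.app _ z = σ),
      l ⟨SSet.stdSimplex.objEquiv (q.app _ z), by rw [pullback_w p i sq, hz]⟩ = z := by
    intro z hz
    apply pullback_ext p i sq
    · rw [hl1, hz]
    · rw [hl2]
  have := key ⟨SSet.stdSimplex.objEquiv (q.app _ x), by rw [pullback_w p i sq, hx]⟩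
    ⟨SSet.stdSimplex.objEquiv (q.app _ y), by rw [pullback_w p i sq, hy]⟩
  simpa only [e x hx, e y hy] using this

end LegAux

lemma isIso_pre_aux {C : Type u₂} [Category.{v₂} C]
    {n : ℕ} (i : Fin (n + 1)) {P K : SSet.{0}} (p : P ⟶ K)
    (q : P ⟶ SSet.stdSimplex.obj (SimplexCategory.mk (n + 1)))
    (g : K ⟶ SSet.stdSimplex.obj (SimplexCategory.mk n))
    (sq : IsPullback p q g (SSet.stdSimplex.map (SimplexCategory.σ i)))
    (F : SimplexCat K ⥤ C) (hF : BoundedDiagram F) [HasColimit F]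
    [HasColimit (simplexMap p ⋙ F)] :
    IsIso (colimit.pre F (simplexMap p)) := by
  have ex : ∀ (m : SimplexCategory) (σ : K.obj (op m)), ∃ x : P.obj (op m), p.app _ x = σ := by
    intro m σ
    obtain ⟨x, hx, -⟩ := pullback_exists p i sq σ
      (SSet.stdSimplex.objEquiv (g.app _ σ) ≫ SimplexCategory.δ i.succ)
      (by rw [Category.assoc, SimplexCategory.δ_comp_σ_succ, Category.comp_id])
    exact ⟨x, hx⟩
  choose l hl using ex
  let c := colimit.cocone (simplexMap p ⋙ F)
  have indep : ∀ {m : SimplexCategory} (σ : K.obj (op m))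
    (x y : P.obj (op m)) (hx : p.app _ x = σ) (hy : p.app _ y = σ),
    leg p F c σ x hx = leg p F c σ y hy := by
    intro m
    induction m using SimplexCategory.rec with
    | _ m => exact fun σ x y hx hy => leg_indep p F c i hF sq σ x y hx hy
  let d : Cocone F :=
    { pt := c.pt
      ι :=
        { app := fun X => leg p F c (m := X.unop.1.unop) X.unop.2 (l _ X.unop.2) (hl _ _)
          naturality := by
            intro X Y f
            have h := leg_nat p F c (m := X.unop.1.unop) (m' := Y.unop.1.unop) f.unop.val.unop
              X.unop.2 Y.unop.2 f.unop.2 (P.map f.unop.val (l _ Y.unop.2)) (l _ Y.unop.2) rfl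
              (by rw [NatTrans.naturality_apply p]
                  exact (congrArg (K.map f.unop.val) (hl _ _)).trans f.unop.2) (hl _ _)
            exact (h.trans (indep _ _ _ _ (hl _ _))).trans (Category.comp_id _).symm } }
  refine ⟨colimit.desc F d, ?_, ?_⟩
  · apply colimit.hom_ext
    intro X
    rw [colimit.ι_pre_assoc, colimit.ι_desc, Category.comp_id]
    have : leg p F c (m := X.unop.1.unop) (p.app _ X.unop.2) X.unop.2 rfl =
        colimit.ι (simplexMap p ⋙ F) X := by
      refine Eq.trans ?_ (Category.id_comp _)
      change _ ≫ _ = _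
      congr 1
      exact F.map_id (simplexObj K (p.app _ X.unop.2))
    rw [← this]
    exact indep _ _ _ (hl _ _) _
  · apply colimit.hom_ext
    intro X
    rw [colimit.ι_desc_assoc, Category.comp_id]
    have h2 : legι p F c (l _ X.unop.2) ≫ colimit.pre F (simplexMap p) =
        colimit.ι F (simplexObj K (p.app _ (l _ X.unop.2))) := colimit.ι_pre F (simplexMap p) _
    change leg p F c (m := X.unop.1.unop) X.unop.2 (l _ X.unop.2) (hl _ _) ≫ _ = _
    rw [leg, Category.assoc, h2]
    exact colimit.w F (simplexHom K (𝟙 X.unop.1.unop) X.unop.2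
      (p.app _ (l _ X.unop.2)) _)

/-- Let `C` be cocomplete, `s_i : Δ[n+1] ⟶ Δ[n]` the `i`-th degeneracy
map, `g : K ⟶ Δ[n]` any map of simplicial sets and `P = K ×_{Δ[n]} Δ[n+1]` the pullback,
with projection `p : P ⟶ K`.  If `F : 𝐊 ⥤ C` is a bounded diagram, then the induced
morphism `colim_𝐏 (F ∘ p) ⟶ colim_𝐊 F` is an isomorphism. -/
theorem isIso_colimitPre_pullback_degeneracy
    {C : Type u₂} [Category.{v₂} C] [HasColimits C]
    {n : ℕ} (i : Fin (n + 1)) (K : SSet.{0})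
    (g : K ⟶ SSet.stdSimplex.obj (SimplexCategory.mk n))
    (F : SimplexCat K ⥤ C) (hF : BoundedDiagram F) :
    IsIso (colimit.pre F (simplexMap
      (pullback.fst g (SSet.stdSimplex.map (SimplexCategory.σ i))))) := by
  exact isIso_pre_aux i _ _ g (IsPullback.of_hasPullback _ _) F hF
end

section
/- Let M be a model category with all small colimits, let K and L be simplicial sets, let f : L → K be a map, and let Ψ : F → G be a natural transformation between bounded diagrams 𝐊 → M. If Ψ is a cofibration (respectively, a cofibration which is also an objectwise weak equivalence), then the induced morphism colim_𝐋 f*Ψ : colim_𝐋 f*F → colim_𝐋 f*G is a cofibration (respectively, an acyclic cofibration) in M. In particular, if F is cofibrant in Fun^b(𝐊, M), then colim_𝐋 f*F and colim_𝐊 F are cofibrant objects of M. -/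
open CategoryTheory CategoryTheory.Limits

universe w v u v₂ u₂ v₃ u₃

/-- A morphism `f` is a retract of a morphism `g` (in the arrow category). -/
def IsRetractOfArrow {C : Type*} [Category C] {X Y X' Y' : C}
    (f : X ⟶ Y) (g : X' ⟶ Y') : Prop :=
  ∃ (a : X ⟶ X') (a' : X' ⟶ X) (b : Y ⟶ Y') (b' : Y' ⟶ Y),
    a ≫ a' = 𝟙 X ∧ b ≫ b' = 𝟙 Y ∧ a ≫ g = f ≫ b ∧ a' ≫ f = g ≫ b'

/-- A (Quillen) model structure on a category `M`: three distinguished classes of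
morphisms (weak equivalences, fibrations and cofibrations) subject to the axioms
MC2–MC5 (two-out-of-three, retract stability, lifting and factorization).
Bicompleteness (MC1) is imposed separately via `HasLimits`/`HasColimits`. -/
structure ModelStructure (M : Type u) [Category.{v} M] where
  weq : MorphismProperty M
  fib : MorphismProperty M
  cof : MorphismProperty M
  weq_of_isIso : ∀ {X Y : M} (f : X ⟶ Y), IsIso f → weq f
  weq_comp : ∀ {X Y Z : M} (f : X ⟶ Y) (g : Y ⟶ Z), weq f → weq g → weq (f ≫ g)
  weq_of_comp_left : ∀ {X Y Z : M} (f : X ⟶ Y) (g : Y ⟶ Z), weq f → weq (f ≫ g) → weq g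
  weq_of_comp_right : ∀ {X Y Z : M} (f : X ⟶ Y) (g : Y ⟶ Z), weq g → weq (f ≫ g) → weq f
  weq_retract : ∀ {X Y X' Y' : M} {f : X ⟶ Y} {g : X' ⟶ Y'},
    IsRetractOfArrow f g → weq g → weq f
  fib_retract : ∀ {X Y X' Y' : M} {f : X ⟶ Y} {g : X' ⟶ Y'},
    IsRetractOfArrow f g → fib g → fib f
  cof_retract : ∀ {X Y X' Y' : M} {f : X ⟶ Y} {g : X' ⟶ Y'},
    IsRetractOfArrow f g → cof g → cof f
  lifting_cof_acyclicFib : ∀ {A B X Y : M} (i : A ⟶ B) (p : X ⟶ Y),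
    cof i → fib p → weq p → HasLiftingProperty i p
  lifting_acyclicCof_fib : ∀ {A B X Y : M} (i : A ⟶ B) (p : X ⟶ Y),
    cof i → weq i → fib p → HasLiftingProperty i p
  factorization_cof_acyclicFib : ∀ {X Y : M} (f : X ⟶ Y),
    ∃ (Z : M) (i : X ⟶ Z) (p : Z ⟶ Y), cof i ∧ fib p ∧ weq p ∧ i ≫ p = f
  factorization_acyclicCof_fib : ∀ {X Y : M} (f : X ⟶ Y),
    ∃ (Z : M) (i : X ⟶ Z) (p : Z ⟶ Y), cof i ∧ weq i ∧ fib p ∧ i ≫ p = f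

variable {M : Type u} [Category.{v} M]

/-- An object is cofibrant if the map from the initial object to it is a cofibration. -/
def ModelStructure.Cofibrant [HasInitial M] (ms : ModelStructure M) (A : M) : Prop :=
  ms.cof (initial.to A)

/-- An object is fibrant if the map to the terminal object is a fibration. -/
def ModelStructure.Fibrant [HasTerminal M] (ms : ModelStructure M) (X : M) : Prop :=
  ms.fib (terminal.from X)

open Opposite

variable {K : SSet.{0}}

/-- A simplex of a simplicial set is degenerate if it is the image of a
lower-dimensional simplex under a surjective map of `Δ`, i.e. of the form `s_i σ'`. -/
def IsDegenerate (x : K.Elements) : Prop :=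
  ∃ (m : SimplexCategory) (α : x.1.unop ⟶ m) (τ : K.obj (op m)),
    Function.Surjective α.toOrderHom ∧ m.len < x.1.unop.len ∧ K.map α.op τ = x.2

/-- The simplex category of the standard simplex `Δ[n]` is the over category of `[n]`
in `Δ`; a simplex `x` of `K` of dimension `n` induces a functor from it to `𝐊`,
sending `α : [m] ⟶ [n]` to the simplex `x ∘ α`.  This realizes the restriction of
diagrams along `Δ[n] --x--> K`. -/
def toK (x : K.Elements) : Over x.1.unop ⥤ SimplexCat K where
  obj g := op (K.elementsMk (op g.left) (K.map g.hom.op x.2))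
  map {g g'} w :=
    Quiver.Hom.op
      (CategoryOfElements.homMk (K.elementsMk (op g'.left) (K.map g'.hom.op x.2))
        (K.elementsMk (op g.left) (K.map g.hom.op x.2)) w.left.op (by
          dsimp
          rw [← FunctorToTypes.map_comp_apply, ← op_comp, Over.w w]))
  map_id g := rfl
  map_comp w w' := rfl

/-- The canonical morphism in `𝐊` from a face of the simplex `x` to `x`. -/
def toVertexHom (x : K.Elements) (g : Over x.1.unop) : (toK x).obj g ⟶ op x :=
  Quiver.Hom.op
    (CategoryOfElements.homMk x (K.elementsMk (op g.left) (K.map g.hom.op x.2))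
      g.hom.op rfl)

lemma toVertexHom_natural (x : K.Elements) {g g' : Over x.1.unop} (w : g ⟶ g') :
    (toK x).map w ≫ toVertexHom x g' = toVertexHom x g := by
  apply Quiver.Hom.unop_inj
  apply Subtype.ext
  exact congrArg Quiver.Hom.op (Over.w w)

variable {M : Type u} [Category.{v} M] [HasColimits M]

/-- The restriction of a diagram `F : 𝐊 ⥤ M` along `∂Δ[n] ↪ Δ[n] --x--> K`:
the simplex category of `∂Δ[n]` is the full subcategory of that of `Δ[n]` on the
non-surjective maps `[m] ⟶ [n]`. -/
def bdryRestrict (x : K.Elements) (F : SimplexCat K ⥤ M) :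
    ObjectProperty.FullSubcategory (fun g : Over x.1.unop => ¬ Function.Surjective g.hom.toOrderHom) ⥤ M :=
  ObjectProperty.ι _ ⋙ toK x ⋙ F

/-- The canonical cocone on the boundary restriction with vertex `F(x)`. -/
noncomputable def bdryCocone (x : K.Elements) (F : SimplexCat K ⥤ M) :
    Cocone (bdryRestrict x F) where
  pt := F.obj (op x)
  ι :=
    { app := fun b => F.map (toVertexHom x b.obj)
      naturality := fun b b' w => by
        dsimp [bdryRestrict]
        rw [Category.comp_id, ← F.map_comp, toVertexHom_natural] }

/-- The canonical morphism `colim_{∂𝚫[n]} F ⟶ F(x)` for a simplex `x` of `K`. -/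
noncomputable def bdryToVertex (x : K.Elements) (F : SimplexCat K ⥤ M) :
    colimit (bdryRestrict x F) ⟶ F.obj (op x) :=
  colimit.desc _ (bdryCocone x F)

/-- The morphism `colim_{∂𝚫[n]} F ⟶ colim_{∂𝚫[n]} G` induced by `Ψ : F ⟶ G`. -/
noncomputable def bdryMap (x : K.Elements) {F G : SimplexCat K ⥤ M} (Ψ : F ⟶ G) :
    colimit (bdryRestrict x F) ⟶ colimit (bdryRestrict x G) :=
  colimMap (Functor.whiskerLeft (ObjectProperty.ι _ ⋙ toK x) Ψ)

/-- For `Ψ : F ⟶ G` and a simplex `x`, the canonical map `M_Ψ(x) ⟶ G(x)`, where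
`M_Ψ(x)` is the pushout of `F(x) ← colim_{∂𝚫[n]} F → colim_{∂𝚫[n]} G`. -/
noncomputable def latchingComparison (x : K.Elements) {F G : SimplexCat K ⥤ M}
    (Ψ : F ⟶ G) :
    pushout (bdryToVertex x F) (bdryMap x Ψ) ⟶ G.obj (op x) :=
  pushout.desc (Ψ.app (op x)) (bdryToVertex x G) (by
    apply colimit.hom_ext
    intro b
    simp only [bdryToVertex, bdryMap, bdryCocone, colimit.ι_desc_assoc]
    refine (Ψ.naturality (toVertexHom x b.obj)).trans (Eq.symm ?_)
    refine (ι_colimMap_assoc (F := bdryRestrict x G) (G := bdryRestrict x F)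
      (Functor.whiskerLeft (ObjectProperty.ι _ ⋙ toK x) Ψ) b _).trans ?_
    exact congrArg (fun k => Ψ.app ((toK x).obj b.obj) ≫ k) (colimit.ι_desc (bdryCocone x G) b))

/-- A natural transformation `Ψ : F ⟶ G` between bounded diagrams is a *cofibration*
if for every non-degenerate simplex `x` of `K` the canonical map `M_Ψ(x) ⟶ G(x)` is a
cofibration in `M`. -/
def IsCofibrationOfDiagrams (ms : ModelStructure M) {F G : SimplexCat K ⥤ M}
    (Ψ : F ⟶ G) : Prop :=
  ∀ x : K.Elements, ¬ IsDegenerate x → ms.cof (latchingComparison x Ψ)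

/-- A bounded diagram `F` is *cofibrant* if `∅ ⟶ F` is a cofibration, i.e. if
`colim_{∂𝚫[n]} F ⟶ F(x)` is a cofibration for every non-degenerate simplex `x`. -/
def CofibrantDiagram (ms : ModelStructure M) (F : SimplexCat K ⥤ M) : Prop :=
  ∀ x : K.Elements, ¬ IsDegenerate x → ms.cof (bdryToVertex x F)


namespace ColimPB

variable {K : SSet.{0}}

abbrev kdim (x : SimplexCat K) : ℕ := x.unop.1.unop.len

def U {x y : SimplexCat K} (e : x ⟶ y) : x.unop.1.unop ⟶ y.unop.1.unop := e.unop.val.unop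

lemma kext {x y : SimplexCat K} {e e' : x ⟶ y} (h : U e = U e') : e = e' := by
  apply Quiver.Hom.unop_inj
  apply Subtype.ext
  exact Quiver.Hom.unop_inj h

lemma U_comp {x y z : SimplexCat K} (e : x ⟶ y) (e' : y ⟶ z) : U (e ≫ e') = U e ≫ U e' := rfl

lemma U_id (x : SimplexCat K) : U (𝟙 x) = 𝟙 _ := rfl

lemma U_spec {x y : SimplexCat K} (e : x ⟶ y) : K.map (U e).op y.unop.2 = x.unop.2 :=
  e.unop.property

def kmk {x y : SimplexCat K} (w : x.unop.1.unop ⟶ y.unop.1.unop)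
    (h : K.map w.op y.unop.2 = x.unop.2) : x ⟶ y :=
  Quiver.Hom.op (CategoryOfElements.homMk y.unop x.unop w.op h)

lemma U_kmk {x y : SimplexCat K} (w : x.unop.1.unop ⟶ y.unop.1.unop)
    (h : K.map w.op y.unop.2 = x.unop.2) : U (kmk w h) = w := rfl

lemma map_comp_app {a b c : SimplexCategory} (u : a ⟶ b) (v : b ⟶ c) (t : K.obj (op c)) :
    K.map (u ≫ v).op t = K.map u.op (K.map v.op t) := by
  rw [op_comp, Functor.map_comp_apply]

lemma map_id_app {a : SimplexCategory} (t : K.obj (op a)) : K.map (𝟙 a : a ⟶ a).op t = t := by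
  simp

/-- pullback of a simplex along a map in `Δ` -/
def pull (y : SimplexCat K) {a : SimplexCategory} (w : a ⟶ y.unop.1.unop) : SimplexCat K :=
  op (K.elementsMk (op a) (K.map w.op y.unop.2))

def pullHom (y : SimplexCat K) {a : SimplexCategory} (w : a ⟶ y.unop.1.unop) : pull y w ⟶ y :=
  kmk (x := pull y w) w rfl

lemma exists_hom {x y z : SimplexCat K} (c : x ⟶ z) (q : y ⟶ z)
    (w : x.unop.1.unop ⟶ y.unop.1.unop) (h : w ≫ U q = U c) :
    ∃ e : x ⟶ y, U e = w ∧ e ≫ q = c := by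
  have : K.map w.op y.unop.2 = x.unop.2 := by
    rw [← U_spec q, ← map_comp_app, h, U_spec]
  exact ⟨kmk w this, rfl, kext h⟩

/-- `ρ` maps to a simplex of dimension `< n`. -/
def DK (n : ℕ) (ρ : SimplexCat K) : Prop := ∃ τ : SimplexCat K, kdim τ < n ∧ Nonempty (ρ ⟶ τ)

lemma DK.of_hom {n : ℕ} {ρ ρ' : SimplexCat K} (h : DK n ρ') (e : ρ ⟶ ρ') : DK n ρ := by
  obtain ⟨τ, h, ⟨c⟩⟩ := h
  exact ⟨τ, h, ⟨e ≫ c⟩⟩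

lemma DK.mono {n m : ℕ} {ρ : SimplexCat K} (h : DK n ρ) (hn : n ≤ m) : DK m ρ := by
  obtain ⟨τ, h, c⟩ := h
  exact ⟨τ, by omega, c⟩

abbrev Srj {a b : SimplexCategory} (w : a ⟶ b) : Prop := Function.Surjective w.toOrderHom

lemma DK_of_not_surj {ρ σ : SimplexCat K} (q : ρ ⟶ σ) (h : ¬ Srj (U q)) : DK (kdim σ) ρ := by
  rcases σ with ⟨⟨⟨⟨k⟩⟩, t⟩⟩
  cases k with
  | zero =>
    exfalso; apply h
    intro i
    exact ⟨0, Subsingleton.elim (α := Fin 1) _ _⟩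
  | succ k =>
    let w : ρ.unop.1.unop ⟶ SimplexCategory.mk (k + 1) := U q
    obtain ⟨i, θ, hθ⟩ := SimplexCategory.eq_comp_δ_of_not_surjective w h
    obtain ⟨e, -, -⟩ := exists_hom q
      (pullHom (op (K.elementsMk (op (SimplexCategory.mk (k + 1))) t)) (SimplexCategory.δ i))
      θ hθ.symm
    exact ⟨_, Nat.lt_succ_self k, ⟨e⟩⟩

lemma exists_section {ρ σ : SimplexCat K} (q : ρ ⟶ σ) (h : Srj (U q)) :
    ∃ s : σ ⟶ ρ, s ≫ q = 𝟙 σ := by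
  have : Epi (U q) := SimplexCategory.epi_iff_surjective.2 h
  have := isSplitEpi_of_epi (U q)
  obtain ⟨s, -, hs⟩ := exists_hom (𝟙 σ) q (section_ (U q)) (IsSplitEpi.id _)
  exact ⟨s, hs⟩

lemma not_surj_of_DK {ψ ρ σ : SimplexCat K} (q : ψ ⟶ σ) (hψ : ¬ DK (kdim σ) ψ)
    (e : ρ ⟶ σ) (hρ : DK (kdim σ) ρ) : ¬ Srj (U e) := by
  intro h
  obtain ⟨s, -⟩ := exists_section e h
  exact hψ (hρ.of_hom (q ≫ s))

lemma nondeg_of {ψ σ : SimplexCat K} (q : ψ ⟶ σ) (hψ : ¬ DK (kdim σ) ψ) :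
    ¬ IsDegenerate σ.unop := by
  rintro ⟨m, α, τ, -, hm, hτ⟩
  exact hψ ⟨op (K.elementsMk (op m) τ), hm, ⟨q ≫ kmk (y := op (K.elementsMk (op m) τ)) α hτ⟩⟩

lemma surj_of_len_eq {a b : SimplexCategory} (h : a.len = b.len) (w : a ⟶ b) (hw : Srj w)
    (i : Fin (a.len + 1)) : (w.toOrderHom i).val = i.val := by
  induction a using SimplexCategory.rec with | _ a
  induction b using SimplexCategory.rec with | _ b
  obtain rfl : a = b := h
  have : Epi w := SimplexCategory.epi_iff_surjective.2 hw
  have := SimplexCategory.eq_id_of_epi w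
  subst this
  rfl

/-- two morphisms to a minimal simplex agree -/
lemma hom_unique {ψ σ : SimplexCat K} (hψ : ¬ DK (kdim σ) ψ) (q q' : ψ ⟶ σ) : q = q' := by
  have hs : Srj (U q) := by by_contra h; exact hψ (DK_of_not_surj q h)
  apply kext
  ext i : 3
  by_contra hne
  obtain ⟨g, hg⟩ := hs.hasRightInverse
  -- section through i
  classical
  let sf : Fin (kdim σ + 1) → Fin (kdim ψ + 1) := fun j => if j = (U q).toOrderHom i then i else g j
  have hsf : ∀ j, (U q).toOrderHom (sf j) = j := by
    intro j
    by_cases hj : j = (U q).toOrderHom i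
    · simp only [sf, if_pos hj]; exact hj.symm
    · simp only [sf, if_neg hj]; exact hg j
  have hm : Monotone sf := by
    intro j j' hjj
    by_contra hlt
    have h1 := (U q).toOrderHom.monotone (le_of_not_ge hlt)
    rw [hsf, hsf] at h1
    exact hlt (by rw [le_antisymm hjj h1])
  let s : σ.unop.1.unop ⟶ ψ.unop.1.unop := SimplexCategory.Hom.mk ⟨sf, hm⟩
  obtain ⟨c, hc, -⟩ := exists_hom (𝟙 σ) q s (by ext j : 3; exact hsf j)
  have hcs : Srj (U (c ≫ q')) := by
    by_contra h
    exact hψ ((DK_of_not_surj _ h).of_hom q)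
  have h2 := surj_of_len_eq rfl _ hcs ((U q).toOrderHom i)
  apply hne
  apply Fin.ext
  rw [← h2, U_comp, hc]
  change ((U q').toOrderHom (sf ((U q).toOrderHom i))).val = _
  simp [sf]

/-- if `ψ` maps minimally to `σ` and `σ'` then there is a map `σ' ⟶ σ`. -/
lemma exists_root_hom {ψ σ σ' : SimplexCat K} (hd : kdim σ = kdim σ') (hψ : ¬ DK (kdim σ) ψ)
    (q : ψ ⟶ σ) (q' : ψ ⟶ σ') : Nonempty (σ' ⟶ σ) := by
  have hs : Srj (U q') := by by_contra h; exact hψ (hd ▸ DK_of_not_surj q' h)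
  obtain ⟨s, -⟩ := exists_section q' hs
  exact ⟨s ≫ q⟩

end ColimPB

namespace ColimPB

variable {K : SSet.{0}} {M : Type u} [Category.{v} M]

/-- a family of maps `G ρ ⟶ X` indexed by `ρ ⟶ ψ`, natural in `ρ`. -/
def VNat (G : SimplexCat K ⥤ M) {X : M} {n : ℕ} {ψ : SimplexCat K}
    (V : ∀ (ρ : SimplexCat K) (_ : ρ ⟶ ψ), DK n ρ → (G.obj ρ ⟶ X)) : Prop :=
  ∀ (ρ ρ' : SimplexCat K) (d : ρ' ⟶ ρ) (e : ρ ⟶ ψ) (h : DK n ρ),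
    V ρ' (d ≫ e) (h.of_hom d) = G.map d ≫ V ρ e h

lemma V_adj {G : SimplexCat K ⥤ M} (hG : BoundedDiagram G) {X : M} {n : ℕ} {ψ σ : SimplexCat K}
    {V : ∀ (ρ : SimplexCat K) (_ : ρ ⟶ ψ), DK n ρ → (G.obj ρ ⟶ X)} (hV : VNat G V)
    (q : ψ ⟶ σ) {ρ : SimplexCat K} (hρ : DK n ρ) (e1 e2 : ρ ⟶ ψ) (hq : e1 ≫ q = e2 ≫ q)
    (t : Fin (kdim ρ + 1)) (hle : ∀ i, (U e1).toOrderHom i ≤ (U e2).toOrderHom i)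
    (hne : ∀ i, i ≠ t → (U e1).toOrderHom i = (U e2).toOrderHom i) : V ρ e1 hρ = V ρ e2 hρ := by
  have hqi : ∀ i, (U q).toOrderHom ((U e1).toOrderHom i) = (U q).toOrderHom ((U e2).toOrderHom i) :=
    fun i => congrArg (fun c => (U c).toOrderHom i) hq
  let st : SimplexCategory.mk (kdim ρ + 1) ⟶ ρ.unop.1.unop := SimplexCategory.σ t
  let d := pullHom ρ st
  let d1 : ρ.unop.1.unop ⟶ SimplexCategory.mk (kdim ρ + 1) := SimplexCategory.δ t.succ
  let d2 : ρ.unop.1.unop ⟶ SimplexCategory.mk (kdim ρ + 1) := SimplexCategory.δ t.castSucc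
  have h1 : d1 ≫ st = 𝟙 _ := SimplexCategory.δ_comp_σ_succ
  have h2 : d2 ≫ st = 𝟙 _ := SimplexCategory.δ_comp_σ_self
  let wf : Fin (kdim ρ + 1 + 1) → Fin (kdim ψ + 1) := fun i =>
    if i ≤ t.castSucc then (U e1).toOrderHom (st.toOrderHom i) else
      (U e2).toOrderHom (st.toOrderHom i)
  have hw : Monotone wf := by
    intro i j hij
    have hs := st.toOrderHom.monotone hij
    simp only [wf]
    split_ifs with a b b
    · exact (U e1).toOrderHom.monotone hs
    · exact ((U e1).toOrderHom.monotone hs).trans (hle _)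
    · exact absurd (hij.trans b) a
    · exact (U e2).toOrderHom.monotone hs
  let w : SimplexCategory.mk (kdim ρ + 1) ⟶ ψ.unop.1.unop := SimplexCategory.Hom.mk ⟨wf, hw⟩
  obtain ⟨ê, hê, -⟩ := exists_hom (d ≫ e1 ≫ q) q w (by
    ext i : 3
    change (U q).toOrderHom (wf i) = (U q).toOrderHom ((U e1).toOrderHom (st.toOrderHom i))
    simp only [wf]
    split_ifs
    · rfl
    · exact (hqi _).symm)
  obtain ⟨c1, hc1, hc1'⟩ := exists_hom (𝟙 ρ) d d1 h1
  obtain ⟨c2, hc2, hc2'⟩ := exists_hom (𝟙 ρ) d d2 h2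
  have hst : Srj st := SimplexCategory.epi_iff_surjective.1
    (inferInstanceAs (Epi (SimplexCategory.σ t)))
  have : IsIso (G.map d) := hG d hst
  have hc : G.map c1 = G.map c2 := by
    rw [← cancel_mono (G.map d), ← G.map_comp, ← G.map_comp, hc1', hc2']
  have k1 : c1 ≫ ê = e1 := by
    apply kext
    rw [U_comp, hê, hc1]
    ext i : 3
    change wf (d1.toOrderHom i) = _
    have hi : st.toOrderHom (d1.toOrderHom i) = i := congrArg (fun c => c.toOrderHom i) h1
    simp only [wf, hi]
    split_ifs with a
    · rfl
    · refine (hne i ?_).symm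
      rintro rfl
      apply a
      change i.succ.succAbove i ≤ _
      simp
  have k2 : c2 ≫ ê = e2 := by
    apply kext
    rw [U_comp, hê, hc2]
    ext i : 3
    change wf (d2.toOrderHom i) = _
    have hi : st.toOrderHom (d2.toOrderHom i) = i := congrArg (fun c => c.toOrderHom i) h2
    simp only [wf, hi]
    split_ifs with a
    · refine (hne i ?_)
      rintro rfl
      change i.castSucc.succAbove i ≤ _ at a
      simp [Fin.le_def] at a
    · rfl
  subst k1 k2
  rw [hV _ _ c1 ê (hρ.of_hom d), hV _ _ c2 ê (hρ.of_hom d), hc]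

lemma V_le {G : SimplexCat K ⥤ M} (hG : BoundedDiagram G) {X : M} {n : ℕ} {ψ σ : SimplexCat K}
    {V : ∀ (ρ : SimplexCat K) (_ : ρ ⟶ ψ), DK n ρ → (G.obj ρ ⟶ X)} (hV : VNat G V)
    (q : ψ ⟶ σ) {ρ : SimplexCat K} (hρ : DK n ρ) (e1 e2 : ρ ⟶ ψ) (hq : e1 ≫ q = e2 ≫ q)
    (hle : ∀ i, (U e1).toOrderHom i ≤ (U e2).toOrderHom i) : V ρ e1 hρ = V ρ e2 hρ := by
  have hqi : ∀ i, (U q).toOrderHom ((U e1).toOrderHom i) = (U q).toOrderHom ((U e2).toOrderHom i) :=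
    fun i => congrArg (fun c => (U c).toOrderHom i) hq
  let wf : ℕ → Fin (kdim ρ + 1) → Fin (kdim ψ + 1) := fun t i =>
    if i.val < t then (U e1).toOrderHom i else (U e2).toOrderHom i
  have hw : ∀ t, Monotone (wf t) := by
    intro t i j hij
    have hij' : i.val ≤ j.val := hij
    simp only [wf]
    split_ifs with a b b
    · exact (U e1).toOrderHom.monotone hij
    · exact ((U e1).toOrderHom.monotone hij).trans (hle _)
    · omega
    · exact (U e2).toOrderHom.monotone hij
  have key : ∀ t, t ≤ kdim ρ + 1 → ∃ e : ρ ⟶ ψ, (∀ i, (U e).toOrderHom i = wf t i) ∧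
      e ≫ q = e1 ≫ q ∧ V ρ e hρ = V ρ e2 hρ := by
    intro t
    induction t with
    | zero => intro _; exact ⟨e2, fun i => by simp [wf], hq.symm, rfl⟩
    | succ t ih =>
      intro ht
      obtain ⟨e, he, heq, hVe⟩ := ih (by omega)
      obtain ⟨e', he', heq'⟩ := exists_hom (e1 ≫ q) q (SimplexCategory.Hom.mk ⟨wf (t + 1), hw _⟩) (by
        ext i : 3
        change (U q).toOrderHom (wf (t + 1) i) = (U q).toOrderHom ((U e1).toOrderHom i)
        simp only [wf]
        split_ifs
        · rfl
        · exact (hqi _).symm)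
      have he'' : ∀ i, (U e').toOrderHom i = wf (t + 1) i := by
        intro i; rw [he']; rfl
      refine ⟨e', he'', heq', ?_⟩
      rw [← hVe]
      refine V_adj hG hV q hρ e' e (heq'.trans heq.symm) ⟨t, by omega⟩ ?_ ?_
      · intro i
        rw [he, he'']
        simp only [wf]
        split_ifs
        · exact le_rfl
        · exact hle _
        · omega
        · exact le_rfl
      · intro i hi
        have : i.val ≠ t := fun h => hi (Fin.ext h)
        rw [he, he'']
        simp only [wf]
        split_ifs <;> first | rfl | omega
  obtain ⟨e, he, -, hVe⟩ := key _ le_rfl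
  rw [← hVe]
  congr 1
  apply kext
  ext i : 3
  rw [he]
  simp only [wf]
  rw [if_pos i.2]

lemma V_eq {G : SimplexCat K ⥤ M} (hG : BoundedDiagram G) {X : M} {n : ℕ} {ψ σ : SimplexCat K}
    {V : ∀ (ρ : SimplexCat K) (_ : ρ ⟶ ψ), DK n ρ → (G.obj ρ ⟶ X)} (hV : VNat G V)
    (q : ψ ⟶ σ) {ρ : SimplexCat K} (hρ : DK n ρ) (e1 e2 : ρ ⟶ ψ) (hq : e1 ≫ q = e2 ≫ q) :
    V ρ e1 hρ = V ρ e2 hρ := by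
  have hqi : ∀ i, (U q).toOrderHom ((U e1).toOrderHom i) = (U q).toOrderHom ((U e2).toOrderHom i) :=
    fun i => congrArg (fun c => (U c).toOrderHom i) hq
  let w : ρ.unop.1.unop ⟶ ψ.unop.1.unop := SimplexCategory.Hom.mk
    ((U e1).toOrderHom ⊔ (U e2).toOrderHom)
  obtain ⟨e, he, heq⟩ := exists_hom (e1 ≫ q) q w (by
    ext i : 3
    change (U q).toOrderHom ((U e1).toOrderHom i ⊔ (U e2).toOrderHom i) =
      (U q).toOrderHom ((U e1).toOrderHom i)
    rcases le_total ((U e1).toOrderHom i) ((U e2).toOrderHom i) with h | h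
    · rw [sup_eq_right.2 h, hqi]
    · rw [sup_eq_left.2 h])
  rw [V_le hG hV q hρ e1 e heq.symm, V_le hG hV q hρ e2 e (hq.symm.trans heq.symm)]
  · intro i
    rw [he]
    exact le_sup_right (a := (U e1).toOrderHom i)
  · intro i
    rw [he]
    exact le_sup_left (b := (U e2).toOrderHom i)

end ColimPB

namespace ColimPB

section Core

variable {K : SSet.{0}} {M : Type u} [Category.{v} M] [HasColimits M]
  {J : Type u₂} [Category.{v₂} J]

/-- `φ` behaves like the functor of simplex categories induced by a simplicial map. -/
structure FibLike (φ : J ⥤ SimplexCat K) : Prop where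
  lift : ∀ (y : J) (σ : SimplexCat K) (e : σ ⟶ φ.obj y),
    ∃ (z : J) (β : z ⟶ y) (i : σ ⟶ φ.obj z), IsIso i ∧ i ≫ φ.map β = e
  cart : ∀ {z1 z2 y : J} (β1 : z1 ⟶ y) (β2 : z2 ⟶ y) (i : φ.obj z1 ⟶ φ.obj z2),
    i ≫ φ.map β2 = φ.map β1 → ∃ t : z1 ⟶ z2, φ.map t = i

variable {φ : J ⥤ SimplexCat K} {F G : SimplexCat K ⥤ M} {X Y : M}

/-- A partial lift, defined on the part of `J` of root dimension `< n`. -/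
structure IsPart (Ψ : F ⟶ G) (p : X ⟶ Y) (a : ∀ y : J, F.obj (φ.obj y) ⟶ X)
    (b : ∀ y : J, G.obj (φ.obj y) ⟶ Y) (n : ℕ)
    (H : ∀ y : J, DK n (φ.obj y) → (G.obj (φ.obj y) ⟶ X)) : Prop where
  nat : ∀ (z y : J) (β : z ⟶ y) (h : DK n (φ.obj y)),
    H z (h.of_hom (φ.map β)) = G.map (φ.map β) ≫ H y h
  left : ∀ y h, Ψ.app (φ.obj y) ≫ H y h = a y
  right : ∀ y h, H y h ≫ p = b y

variable {Ψ : F ⟶ G} {p : X ⟶ Y} {a : ∀ y : J, F.obj (φ.obj y) ⟶ X}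
  {b : ∀ y : J, G.obj (φ.obj y) ⟶ Y} {n : ℕ}
  {H : ∀ y : J, DK n (φ.obj y) → (G.obj (φ.obj y) ⟶ X)}

lemma exists_V (hφ : FibLike φ) (hH : IsPart Ψ p a b n H)
    (ha : ∀ (z y : J) (β : z ⟶ y), a z = F.map (φ.map β) ≫ a y)
    (hb : ∀ (z y : J) (β : z ⟶ y), b z = G.map (φ.map β) ≫ b y) (y : J) :
    ∃ V : ∀ (ρ : SimplexCat K) (_ : ρ ⟶ φ.obj y), DK n ρ → (G.obj ρ ⟶ X),
      VNat G V ∧ (∀ z (β : z ⟶ y) h, V _ (φ.map β) h = H z h) ∧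
      (∀ ρ e h, Ψ.app ρ ≫ V ρ e h = F.map e ≫ a y) ∧
      (∀ ρ e h, V ρ e h ≫ p = G.map e ≫ b y) := by
  choose z β i hi hz using hφ.lift y
  let V : ∀ (ρ : SimplexCat K) (_ : ρ ⟶ φ.obj y), DK n ρ → (G.obj ρ ⟶ X) := fun ρ e h =>
    G.map (i ρ e) ≫ H (z ρ e) (h.of_hom (have := hi ρ e; inv (i ρ e)))
  have hV : ∀ (ρ : SimplexCat K) (e : ρ ⟶ φ.obj y) (h : DK n ρ) (z' : J) (β' : z' ⟶ y)
      (i' : ρ ⟶ φ.obj z') (_ : i' ≫ φ.map β' = e) (h' : DK n (φ.obj z')),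
      V ρ e h = G.map i' ≫ H z' h' := by
    intro ρ e h z' β' i' hi' h'
    have := hi ρ e
    obtain ⟨t, ht⟩ := hφ.cart (β ρ e) β' (inv (i ρ e) ≫ i') (by
      rw [Category.assoc, hi', IsIso.inv_comp_eq, hz])
    have h2 := hH.nat _ _ t h'
    simp only [V]
    rw [h2, ht, ← Category.assoc, ← G.map_comp, IsIso.hom_inv_id_assoc]
  refine ⟨V, ?_, ?_, ?_, ?_⟩
  · intro ρ ρ' d e h
    have := hi ρ e
    have hze : DK n (φ.obj (z ρ e)) := h.of_hom (inv (i ρ e))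
    obtain ⟨z', β', i', hi', hz'⟩ := hφ.lift (z ρ e) ρ' (d ≫ i ρ e)
    rw [hV ρ' (d ≫ e) (h.of_hom d) z' (β' ≫ β ρ e) i'
      (by rw [φ.map_comp, ← Category.assoc, hz', Category.assoc, hz])
      (hze.of_hom (φ.map β')), hH.nat _ _ β' hze, ← Category.assoc, ← G.map_comp, hz',
      G.map_comp, Category.assoc]
  · intro z' β' h
    rw [hV _ (φ.map β') h z' β' (𝟙 _) (Category.id_comp _) h, G.map_id, Category.id_comp]
  · intro ρ e h
    simp only [V]
    rw [← Category.assoc, ← Ψ.naturality, Category.assoc, hH.left, ha _ _ (β ρ e),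
      ← Category.assoc, ← F.map_comp, hz]
  · intro ρ e h
    simp only [V]
    rw [Category.assoc, hH.right, hb _ _ (β ρ e), ← Category.assoc, ← G.map_comp, hz]

/-- `h` is an admissible value of the extension of the partial lift at `y`. -/
structure Good (Ψ : F ⟶ G) (p : X ⟶ Y) (a : ∀ y : J, F.obj (φ.obj y) ⟶ X)
    (b : ∀ y : J, G.obj (φ.obj y) ⟶ Y)
    (H : ∀ y : J, DK n (φ.obj y) → (G.obj (φ.obj y) ⟶ X)) (y : J)
    (h : G.obj (φ.obj y) ⟶ X) : Prop where
  nat : ∀ (z : J) (β : z ⟶ y) (hz : DK n (φ.obj z)), H z hz = G.map (φ.map β) ≫ h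
  left : Ψ.app (φ.obj y) ≫ h = a y
  right : h ≫ p = b y

lemma exists_good (hF : BoundedDiagram F) (hG : BoundedDiagram G)
    (hφ : FibLike φ) (hH : IsPart Ψ p a b n H)
    (ha : ∀ (z y : J) (β : z ⟶ y), a z = F.map (φ.map β) ≫ a y)
    (hb : ∀ (z y : J) (β : z ⟶ y), b z = G.map (φ.map β) ≫ b y)
    (hab : ∀ y, a y ≫ p = Ψ.app (φ.obj y) ≫ b y) (y : J) (hy : ¬ DK n (φ.obj y))
    (σ : SimplexCat K) (hσ : kdim σ = n) (q : φ.obj y ⟶ σ)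
    (hlp : HasLiftingProperty (latchingComparison σ.unop Ψ) p) :
    ∃ ℓ : G.obj σ ⟶ X, Good Ψ p a b H y (G.map q ≫ ℓ) := by
  subst hσ
  obtain ⟨V, hV, hVH, hVl, hVr⟩ := exists_V hφ hH ha hb y
  have hq : Srj (U q) := by by_contra h; exact hy (DK_of_not_surj q h)
  obtain ⟨s, hs⟩ := exists_section q hq
  have hg : ∀ g : Over σ.unop.1.unop, ¬ Srj g.hom → DK (kdim σ) ((toK σ.unop).obj g) := by
    intro g hg
    exact DK_of_not_surj (σ := σ) (toVertexHom σ.unop g) hg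
  let c : Cocone (bdryRestrict σ.unop G) :=
    { pt := X
      ι :=
        { app := fun g => V _ (toVertexHom σ.unop g.obj ≫ s) (hg g.obj g.property)
          naturality := fun g g' w => by
            refine Eq.trans ?_ (Category.comp_id _).symm
            have h1 := hV _ _ ((toK σ.unop).map w.hom) (toVertexHom σ.unop g'.obj ≫ s)
              (hg g'.obj g'.property)
            refine h1.symm.trans ?_
            congr 1
            rw [← Category.assoc, toVertexHom_natural] } }
  have sq1 : bdryToVertex σ.unop F ≫ (F.map s ≫ a y) = bdryMap σ.unop Ψ ≫ colimit.desc _ c := by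
    apply colimit.hom_ext
    intro g
    have e1 : colimit.ι (bdryRestrict σ.unop F) g ≫ bdryToVertex σ.unop F =
      F.map (toVertexHom σ.unop g.obj) := colimit.ι_desc _ _
    have e2 : colimit.ι (bdryRestrict σ.unop F) g ≫ bdryMap σ.unop Ψ =
      Ψ.app ((toK σ.unop).obj g.obj) ≫ colimit.ι (bdryRestrict σ.unop G) g :=
      ι_colimMap (F := bdryRestrict σ.unop G) (G := bdryRestrict σ.unop F)
        (Functor.whiskerLeft (ObjectProperty.ι _ ⋙ toK σ.unop) Ψ) g
    rw [← Category.assoc, e1, ← Category.assoc, e2]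
    refine Eq.trans ?_ (Category.assoc _ _ _).symm
    refine Eq.trans ?_ (congrArg (fun k => Ψ.app ((toK σ.unop).obj g.obj) ≫ k)
      (colimit.ι_desc c g)).symm
    refine Eq.trans ?_ (hVl _ (toVertexHom σ.unop g.obj ≫ s) (hg g.obj g.property)).symm
    rw [F.map_comp, Category.assoc]
    rfl
  have sq : CommSq (pushout.desc (F.map s ≫ a y) (colimit.desc _ c) sq1)
      (latchingComparison σ.unop Ψ) p (G.map s ≫ b y) := by
    constructor
    apply pushout.hom_ext
    · rw [← Category.assoc, pushout.inl_desc, ← Category.assoc, latchingComparison,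
        pushout.inl_desc, Category.assoc, hab, ← Category.assoc, Ψ.naturality, Category.assoc]
    · rw [← Category.assoc, pushout.inr_desc, ← Category.assoc, latchingComparison,
        pushout.inr_desc]
      apply colimit.hom_ext
      intro g
      have e1 : colimit.ι (bdryRestrict σ.unop G) g ≫ bdryToVertex σ.unop G =
        G.map (toVertexHom σ.unop g.obj) := colimit.ι_desc _ _
      rw [← Category.assoc, colimit.ι_desc, ← Category.assoc, e1]
      refine (hVr _ (toVertexHom σ.unop g.obj ≫ s) (hg g.obj g.property)).trans ?_
      rw [G.map_comp, Category.assoc]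
      rfl
  have hl := sq.fac_left
  have hr := sq.fac_right
  generalize sq.lift = ℓ at hl hr
  refine ⟨ℓ, ?_, ?_, ?_⟩
  · intro z β hz
    have hns : ¬ Srj (U (φ.map β ≫ q)) := not_surj_of_DK q hy _ hz
    let g : Over σ.unop.1.unop := Over.mk (U (φ.map β ≫ q))
    let e : φ.obj z ⟶ (toK σ.unop).obj g := kmk (y := (toK σ.unop).obj g) (𝟙 _) (by
      exact Eq.trans (map_id_app _) (U_spec (φ.map β ≫ q)))
    have he : e ≫ toVertexHom σ.unop g = φ.map β ≫ q := kext (Category.id_comp _)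
    have hℓ : G.map (toVertexHom σ.unop g) ≫ ℓ = V _ (toVertexHom σ.unop g ≫ s) (hg g hns) := by
      have h1 := congrArg (fun k => colimit.ι (bdryRestrict σ.unop G) ⟨g, hns⟩ ≫ pushout.inr _ _ ≫ k) hl
      have h2 : colimit.ι (bdryRestrict σ.unop G) ⟨g, hns⟩ ≫ bdryToVertex σ.unop G =
        G.map (toVertexHom σ.unop g) := colimit.ι_desc _ _
      simp only [latchingComparison, pushout.inr_desc, pushout.inr_desc_assoc] at h1
      rw [← Category.assoc, h2, colimit.ι_desc] at h1
      exact h1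
    rw [← Category.assoc, ← G.map_comp, ← he, G.map_comp, Category.assoc]
    refine Eq.trans ?_ (congrArg (fun k => G.map e ≫ k) hℓ.symm)
    rw [← hVH z β hz]
    refine Eq.trans ?_ (hV _ _ e (toVertexHom σ.unop g ≫ s) (hg g hns))
    apply V_eq hG hV q
    rw [Category.assoc, Category.assoc, hs, Category.comp_id, he]
  · have h1 := congrArg (fun k => pushout.inl _ _ ≫ k) hl
    simp only [latchingComparison, pushout.inl_desc, pushout.inl_desc_assoc] at h1
    rw [← Category.assoc, ← Ψ.naturality, Category.assoc]
    refine (congrArg (fun k => F.map q ≫ k) h1).trans ?_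
    have : IsIso (F.map q) := hF q hq
    have h3 : F.map q ≫ F.map s = 𝟙 _ := by
      rw [← cancel_mono (F.map q), Category.assoc, ← F.map_comp s, hs]; simp
    rw [← Category.assoc, h3, Category.id_comp]
  · rw [Category.assoc]
    refine (congrArg (fun k => G.map q ≫ k) hr).trans ?_
    have : IsIso (G.map q) := hG q hq
    have h3 : G.map q ≫ G.map s = 𝟙 _ := by
      rw [← cancel_mono (G.map q), Category.assoc, ← G.map_comp s, hs]; simp
    rw [← Category.assoc, h3, Category.id_comp]

lemma good_pull (ha : ∀ (z y : J) (β : z ⟶ y), a z = F.map (φ.map β) ≫ a y)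
    (hb : ∀ (z y : J) (β : z ⟶ y), b z = G.map (φ.map β) ≫ b y) {y y' : J} (β : y ⟶ y')
    {h : G.obj (φ.obj y') ⟶ X} (hh : Good Ψ p a b H y' h) :
    Good Ψ p a b H y (G.map (φ.map β) ≫ h) where
  nat z γ hz := by
    rw [hh.nat z (γ ≫ β) hz, φ.map_comp, G.map_comp, Category.assoc]
  left := by
    rw [← Category.assoc, ← Ψ.naturality, Category.assoc, hh.left, ← ha]
  right := by
    rw [Category.assoc, hh.right, ← hb]

lemma good_push (hF : BoundedDiagram F) (hG : BoundedDiagram G)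
    (hφ : FibLike φ) (hH : IsPart Ψ p a b n H)
    (ha : ∀ (z y : J) (β : z ⟶ y), a z = F.map (φ.map β) ≫ a y)
    (hb : ∀ (z y : J) (β : z ⟶ y), b z = G.map (φ.map β) ≫ b y) {y y' : J} (β : y ⟶ y')
    (hy : ¬ DK n (φ.obj y)) (σ : SimplexCat K) (hσ : kdim σ = n) (r : φ.obj y' ⟶ σ)
    (ℓ : G.obj σ ⟶ X) (hh : Good Ψ p a b H y (G.map (φ.map β ≫ r) ≫ ℓ)) :
    Good Ψ p a b H y' (G.map r ≫ ℓ) := by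
  subst hσ
  have hy' : ¬ DK (kdim σ) (φ.obj y') := fun h => hy (h.of_hom (φ.map β))
  have hr : Srj (U r) := by by_contra h; exact hy' (DK_of_not_surj r h)
  have hq : Srj (U (φ.map β ≫ r)) := by by_contra h; exact hy (DK_of_not_surj _ h)
  obtain ⟨s, hs⟩ := exists_section _ hq
  constructor
  · intro z γ hz
    obtain ⟨V, hV, hVH, -, -⟩ := exists_V hφ hH ha hb y'
    obtain ⟨z', γ', i, hi, hi'⟩ := hφ.lift y _ (φ.map γ ≫ r ≫ s)
    have hz' : DK (kdim σ) (φ.obj z') := hz.of_hom (inv i)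
    have h1 := hh.nat z' γ' hz'
    rw [← hVH z' (γ' ≫ β) hz'] at h1
    have h2 := hV _ _ i (φ.map (γ' ≫ β)) hz'
    rw [h1] at h2
    rw [← hVH z γ hz]
    refine (V_eq hG hV r _ _ (i ≫ φ.map (γ' ≫ β)) ?_).trans (h2.trans ?_)
    · rw [φ.map_comp, ← Category.assoc i, hi']
      simp only [Category.assoc] at hs ⊢
      rw [hs, Category.comp_id]
    · simp only [← Category.assoc, ← G.map_comp]
      congr 2
      rw [hi']
      simp only [Category.assoc] at hs ⊢
      rw [hs, Category.comp_id]
  · have : IsIso (F.map r) := hF r hr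
    have : IsIso (F.map (φ.map β ≫ r)) := hF _ hq
    rw [F.map_comp] at this
    have : IsIso (F.map (φ.map β)) := IsIso.of_isIso_comp_right _ (F.map r)
    rw [← cancel_epi (F.map (φ.map β)), ← ha, ← hh.left, G.map_comp]
    rw [← Category.assoc, Ψ.naturality]
    simp only [Category.assoc]
  · have : IsIso (G.map r) := hG r hr
    have : IsIso (G.map (φ.map β ≫ r)) := hG _ hq
    rw [G.map_comp] at this
    have : IsIso (G.map (φ.map β)) := IsIso.of_isIso_comp_right _ (G.map r)
    rw [← cancel_epi (G.map (φ.map β)), ← hb, ← hh.right, G.map_comp]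
    simp only [Category.assoc]

end Core

end ColimPB

namespace ColimPB

section Step

variable {K : SSet.{0}} {M : Type u} [Category.{v} M] [HasColimits M]
  {J : Type u₂} [Category.{v₂} J]
  {φ : J ⥤ SimplexCat K} {F G : SimplexCat K ⥤ M} {X Y : M}
  {Ψ : F ⟶ G} {p : X ⟶ Y} {a : ∀ y : J, F.obj (φ.obj y) ⟶ X}
  {b : ∀ y : J, G.obj (φ.obj y) ⟶ Y} {n : ℕ}
  {H : ∀ y : J, DK n (φ.obj y) → (G.obj (φ.obj y) ⟶ X)}

lemma step (hF : BoundedDiagram F) (hG : BoundedDiagram G)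
    (hφ : FibLike φ) (hH : IsPart Ψ p a b n H)
    (ha : ∀ (z y : J) (β : z ⟶ y), a z = F.map (φ.map β) ≫ a y)
    (hb : ∀ (z y : J) (β : z ⟶ y), b z = G.map (φ.map β) ≫ b y)
    (hab : ∀ y, a y ≫ p = Ψ.app (φ.obj y) ≫ b y)
    (hlp : ∀ (y : J) (σ : SimplexCat K) (_ : φ.obj y ⟶ σ), ¬ DK (kdim σ) (φ.obj y) →
      HasLiftingProperty (latchingComparison σ.unop Ψ) p) :
    ∃ H' : ∀ y : J, DK (n + 1) (φ.obj y) → (G.obj (φ.obj y) ⟶ X),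
      IsPart Ψ p a b (n + 1) H' ∧ ∀ y h h', H' y h' = H y h := by
  classical
  let E := {y : J // DK (n + 1) (φ.obj y) ∧ ¬ DK n (φ.obj y)}
  let R : E → E → Prop := fun y y' => Nonempty (y.1 ⟶ y'.1)
  have hE : ∀ y : E, ∃ σ : SimplexCat K, kdim σ = n ∧ Nonempty (φ.obj y.1 ⟶ σ) := by
    rintro ⟨y, ⟨σ, hσ, hq⟩, hy⟩
    refine ⟨σ, ?_, hq⟩
    by_contra h
    exact hy ⟨σ, by omega, hq⟩
  have hbase : ∀ c : Quot R, ∃ (σ : SimplexCat K) (ℓ : G.obj σ ⟶ X) (q : φ.obj c.out.1 ⟶ σ),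
      kdim σ = n ∧ Good Ψ p a b H c.out.1 (G.map q ≫ ℓ) := by
    intro c
    obtain ⟨σ, hσ, ⟨q⟩⟩ := hE c.out
    obtain ⟨ℓ, hℓ⟩ := exists_good hF hG hφ hH ha hb hab c.out.1 c.out.2.2 σ hσ q
      (hlp c.out.1 σ q (by rw [hσ]; exact c.out.2.2))
    exact ⟨σ, ℓ, q, hσ, hℓ⟩
  choose σ ℓ q hσ hgood using hbase
  have hQ : ∀ y : E, ∃ r : φ.obj y.1 ⟶ σ (Quot.mk R y),
      Good Ψ p a b H y.1 (G.map r ≫ ℓ (Quot.mk R y)) := by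
    intro y
    obtain ⟨c, hc⟩ : ∃ c, c = Quot.mk R y := ⟨_, rfl⟩
    rw [← hc]
    have hstep : ∀ y y' : E, R y y' →
        ((∃ r : φ.obj y.1 ⟶ σ c, Good Ψ p a b H y.1 (G.map r ≫ ℓ c)) ↔
         (∃ r : φ.obj y'.1 ⟶ σ c, Good Ψ p a b H y'.1 (G.map r ≫ ℓ c))) := by
      rintro y y' ⟨β⟩
      constructor
      · rintro ⟨r, hr⟩
        obtain ⟨σ', hσ', ⟨q'⟩⟩ := hE y'
        have hyσ : ¬ DK (kdim (σ c)) (φ.obj y.1) := by rw [hσ]; exact y.2.2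
        obtain ⟨t⟩ := exists_root_hom ((hσ c).trans hσ'.symm) hyσ r (φ.map β ≫ q')
        refine ⟨q' ≫ t, good_push hF hG hφ hH ha hb β y.2.2 (σ c) (hσ c) _ _ ?_⟩
        rw [hom_unique hyσ (φ.map β ≫ q' ≫ t) r]
        exact hr
      · rintro ⟨r, hr⟩
        refine ⟨φ.map β ≫ r, ?_⟩
        rw [G.map_comp, Category.assoc]
        exact good_pull ha hb β hr
    have hgen : ∀ y y' : E, Relation.EqvGen R y y' →
        ((∃ r : φ.obj y.1 ⟶ σ c, Good Ψ p a b H y.1 (G.map r ≫ ℓ c)) ↔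
         (∃ r : φ.obj y'.1 ⟶ σ c, Good Ψ p a b H y'.1 (G.map r ≫ ℓ c))) := by
      intro y y' h
      induction h with
      | rel _ _ h => exact hstep _ _ h
      | refl _ => exact Iff.rfl
      | symm _ _ _ ih => exact ih.symm
      | trans _ _ _ _ _ ih1 ih2 => exact ih1.trans ih2
    refine (hgen c.out y (Quot.eqvGen_exact ?_)).1 ⟨q c, hgood c⟩
    rw [← hc]
    exact Quot.out_eq c
  choose r hr using hQ
  let H' : ∀ y : J, DK (n + 1) (φ.obj y) → (G.obj (φ.obj y) ⟶ X) := fun y h =>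
    if h' : DK n (φ.obj y) then H y h' else
      G.map (r ⟨y, h, h'⟩) ≫ ℓ (Quot.mk R ⟨y, h, h'⟩)
  refine ⟨H', ⟨?_, ?_, ?_⟩, ?_⟩
  · intro z y β h
    by_cases hy : DK n (φ.obj y)
    · have hz : DK n (φ.obj z) := hy.of_hom (φ.map β)
      simp only [H', dif_pos hy, dif_pos hz]
      exact hH.nat z y β hy
    · by_cases hz : DK n (φ.obj z)
      · simp only [H', dif_neg hy, dif_pos hz]
        exact (hr ⟨y, h, hy⟩).nat z β hz
      · simp only [H', dif_neg hy, dif_neg hz]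
        have hc : Quot.mk R ⟨z, h.of_hom (φ.map β), hz⟩ = Quot.mk R ⟨y, h, hy⟩ :=
          Quot.sound ⟨β⟩
        generalize r ⟨z, h.of_hom (φ.map β), hz⟩ = r1
        generalize r ⟨y, h, hy⟩ = r2
        revert r1 r2
        rw [hc]
        intro r1 r2
        rw [hom_unique (by rw [hσ]; exact hz) r1 (φ.map β ≫ r2), G.map_comp, Category.assoc]
  · intro y h
    by_cases hy : DK n (φ.obj y)
    · simp only [H', dif_pos hy]
      exact hH.left y hy
    · simp only [H', dif_neg hy]
      exact (hr ⟨y, h, hy⟩).left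
  · intro y h
    by_cases hy : DK n (φ.obj y)
    · simp only [H', dif_pos hy]
      exact hH.right y hy
    · simp only [H', dif_neg hy]
      exact (hr ⟨y, h, hy⟩).right
  · intro y h h'
    simp only [H', dif_pos h]

/-- The core lifting statement. -/
lemma core (hF : BoundedDiagram F) (hG : BoundedDiagram G) (hφ : FibLike φ)
    (ha : ∀ (z y : J) (β : z ⟶ y), a z = F.map (φ.map β) ≫ a y)
    (hb : ∀ (z y : J) (β : z ⟶ y), b z = G.map (φ.map β) ≫ b y)
    (hab : ∀ y, a y ≫ p = Ψ.app (φ.obj y) ≫ b y)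
    (hlp : ∀ (y : J) (σ : SimplexCat K) (_ : φ.obj y ⟶ σ), ¬ DK (kdim σ) (φ.obj y) →
      HasLiftingProperty (latchingComparison σ.unop Ψ) p) :
    ∃ h : ∀ y : J, G.obj (φ.obj y) ⟶ X,
      (∀ (z y : J) (β : z ⟶ y), h z = G.map (φ.map β) ≫ h y) ∧
      (∀ y, Ψ.app (φ.obj y) ≫ h y = a y) ∧ (∀ y, h y ≫ p = b y) := by
  have h0 : ∀ y : J, ¬ DK 0 (φ.obj y) := by
    rintro y ⟨τ, h, -⟩
    omega
  let T : ℕ → Type _ := fun n =>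
    {H : ∀ y : J, DK n (φ.obj y) → (G.obj (φ.obj y) ⟶ X) // IsPart Ψ p a b n H}
  have hstep : ∀ n (t : T n), ∃ t' : T (n + 1), ∀ y h h', t'.1 y h' = t.1 y h := by
    intro n t
    obtain ⟨H', h1, h2⟩ := step hF hG hφ t.2 ha hb hab hlp
    exact ⟨⟨H', h1⟩, h2⟩
  choose nxt hnxt using hstep
  let t0 : T 0 := ⟨fun y h => absurd h (h0 y), ⟨fun _ y _ h => absurd h (h0 y),
    fun y h => absurd h (h0 y), fun y h => absurd h (h0 y)⟩⟩
  let S : ∀ n, T n := fun n => Nat.rec t0 nxt n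
  have hS : ∀ n y h h', (S (n + 1)).1 y h' = (S n).1 y h := fun n y h h' => hnxt n (S n) y h h'
  have hS' : ∀ m n, n ≤ m → ∀ y h h', (S m).1 y h' = (S n).1 y h := by
    intro m n hnm
    induction m, hnm using Nat.le_induction with
    | base => intro y h h'; rfl
    | succ m hm ih =>
      intro y h h'
      rw [hS m y (h.mono hm) h', ih y h]
  have hD : ∀ y : J, DK (kdim (φ.obj y) + 1) (φ.obj y) := fun y => ⟨φ.obj y, by omega, ⟨𝟙 _⟩⟩
  refine ⟨fun y => (S _).1 y (hD y), ?_, fun y => (S (kdim (φ.obj y) + 1)).2.left y (hD y),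
    fun y => (S (kdim (φ.obj y) + 1)).2.right y (hD y)⟩
  intro z y β
  let m := max (kdim (φ.obj z) + 1) (kdim (φ.obj y) + 1)
  have e1 := hS' m _ (le_max_left _ _) z (hD z) ((hD z).mono (le_max_left _ _))
  have e2 := hS' m _ (le_max_right _ _) y (hD y) ((hD y).mono (le_max_right _ _))
  beta_reduce
  rw [← e1, ← e2]
  exact (S m).2.nat z y β _

lemma core_colim [HasColimit (φ ⋙ F)] [HasColimit (φ ⋙ G)]
    (hF : BoundedDiagram F) (hG : BoundedDiagram G) (hφ : FibLike φ)
    (Ψ : F ⟶ G) (p : X ⟶ Y)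
    (hlp : ∀ (y : J) (σ : SimplexCat K) (_ : φ.obj y ⟶ σ), ¬ DK (kdim σ) (φ.obj y) →
      HasLiftingProperty (latchingComparison σ.unop Ψ) p) :
    HasLiftingProperty (colimMap (Functor.whiskerLeft φ Ψ)) p := by
  constructor
  intro f g sq
  obtain ⟨h, h1, h2, h3⟩ := core (a := fun y => colimit.ι (φ ⋙ F) y ≫ f)
    (b := fun y => colimit.ι (φ ⋙ G) y ≫ g) (p := p) (Ψ := Ψ) hF hG hφ
    (fun z y β => by rw [← colimit.w (φ ⋙ F) β]; simp)
    (fun z y β => by rw [← colimit.w (φ ⋙ G) β]; simp)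
    (fun y => by
      rw [Category.assoc, sq.w, ι_colimMap_assoc]; rfl) hlp
  let c : Cocone (φ ⋙ G) :=
    { pt := X
      ι := { app := h
             naturality := fun z y β => by
               refine Eq.trans (h1 z y β).symm (Category.comp_id _).symm } }
  refine ⟨⟨⟨colimit.desc _ c, ?_, ?_⟩⟩⟩
  · apply colimit.hom_ext
    intro y
    rw [ι_colimMap_assoc, colimit.ι_desc]
    exact h2 y
  · apply colimit.hom_ext
    intro y
    rw [← Category.assoc, colimit.ι_desc]
    exact h3 y

end Step

end ColimPB

namespace ColimPB

lemma fibLike_simplexMap {L K : SSet.{0}} (f : L ⟶ K) : FibLike (simplexMap f) where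
  lift y σ e := by
    let w : σ.unop.1.unop ⟶ y.unop.1.unop := U e
    have hw : K.map (𝟙 σ.unop.1.unop : _ ⟶ σ.unop.1.unop).op
        (f.app _ (L.map w.op y.unop.2)) = σ.unop.2 := by
      rw [map_id_app, NatTrans.naturality_apply]
      exact U_spec e
    have hw' : K.map (𝟙 σ.unop.1.unop : _ ⟶ σ.unop.1.unop).op σ.unop.2 =
        (f.app _ (L.map w.op y.unop.2)) := by
      rw [map_id_app, ← hw, map_id_app]
    let i : σ ⟶ (simplexMap f).obj (pull y w) :=
      kmk (y := (simplexMap f).obj (pull y w)) (𝟙 _) hw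
    let j : (simplexMap f).obj (pull y w) ⟶ σ :=
      kmk (x := (simplexMap f).obj (pull y w)) (𝟙 _) hw'
    refine ⟨pull y w, pullHom y w, i, ⟨j, kext ?_, kext ?_⟩, kext ?_⟩
    · exact Category.id_comp _
    · exact Category.id_comp _
    · exact Category.id_comp _
  cart {z1 z2 y} β1 β2 i h := by
    let w : z1.unop.1.unop ⟶ z2.unop.1.unop :=
      U (x := (simplexMap f).obj z1) (y := (simplexMap f).obj z2) i
    have h' : w ≫ U β2 = U β1 := congrArg U h
    obtain ⟨t, ht, -⟩ := exists_hom β1 β2 w h'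
    exact ⟨t, kext ht⟩

lemma fibLike_bdry {K : SSet.{0}} (x : K.Elements) :
    FibLike (ObjectProperty.ι (fun g : Over x.1.unop => ¬ Function.Surjective g.hom.toOrderHom) ⋙
      toK x) where
  lift y σ e := by
    let w : σ.unop.1.unop ⟶ y.obj.left := U e
    let g : Over x.1.unop := Over.mk (w ≫ y.obj.hom)
    have hg : ¬ Function.Surjective g.hom.toOrderHom := by
      intro h
      apply y.property
      intro k
      obtain ⟨m, hm⟩ := h k
      exact ⟨w.toOrderHom m, hm⟩
    have hw : K.map (w ≫ y.obj.hom).op x.2 = σ.unop.2 := by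
      rw [map_comp_app]
      exact U_spec e
    let i : σ ⟶ (toK x).obj g := kmk (y := (toK x).obj g) (𝟙 _) ((map_id_app _).trans hw)
    let j : (toK x).obj g ⟶ σ := kmk (x := (toK x).obj g) (𝟙 _) ((map_id_app _).trans hw.symm)
    refine ⟨⟨g, hg⟩, ObjectProperty.homMk (Over.homMk w rfl), i, ⟨j, kext ?_, kext ?_⟩, kext ?_⟩
    · exact Category.id_comp _
    · exact Category.id_comp _
    · exact Category.id_comp _
  cart {z1 z2 y} β1 β2 i h := by
    let w : z1.obj.left ⟶ z2.obj.left := U i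
    have h' : w ≫ β2.hom.left = β1.hom.left := congrArg U h
    refine ⟨ObjectProperty.homMk (Over.homMk w ?_), kext rfl⟩
    rw [← Over.w β1.hom, ← Over.w β2.hom, ← Category.assoc, h']

section Model

variable {M : Type u} [Category.{v} M]

lemma cof_of_llp (ms : ModelStructure M) {A B : M} (i : A ⟶ B)
    (h : ∀ {X Y : M} (p : X ⟶ Y), ms.fib p → ms.weq p → HasLiftingProperty i p) : ms.cof i := by
  obtain ⟨Z, j, p, hj, hp, hp', hjp⟩ := ms.factorization_cof_acyclicFib i
  have := h p hp hp'
  have sq : CommSq j i p (𝟙 B) := ⟨by rw [hjp, Category.comp_id]⟩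
  refine ms.cof_retract ⟨𝟙 _, 𝟙 _, sq.lift, p, Category.comp_id _, sq.fac_right, ?_, ?_⟩ hj
  · rw [Category.id_comp, sq.fac_left]
  · rw [Category.id_comp, hjp]

lemma acof_of_llp (ms : ModelStructure M) {A B : M} (i : A ⟶ B)
    (h : ∀ {X Y : M} (p : X ⟶ Y), ms.fib p → HasLiftingProperty i p) :
    ms.cof i ∧ ms.weq i := by
  obtain ⟨Z, j, p, hj, hj', hp, hjp⟩ := ms.factorization_acyclicCof_fib i
  have := h p hp
  have sq : CommSq j i p (𝟙 B) := ⟨by rw [hjp, Category.comp_id]⟩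
  have hr : IsRetractOfArrow i j := by
    refine ⟨𝟙 _, 𝟙 _, sq.lift, p, Category.comp_id _, sq.fac_right, ?_, ?_⟩
    · rw [Category.id_comp, sq.fac_left]
    · rw [Category.id_comp, hjp]
  exact ⟨ms.cof_retract hr hj, ms.weq_retract hr hj'⟩

variable [HasColimits M] {K : SSet.{0}}

lemma bdry_llp {F G : SimplexCat K ⥤ M} (hF : BoundedDiagram F) (hG : BoundedDiagram G)
    (Ψ : F ⟶ G) (x : K.Elements) {X Y : M} (p : X ⟶ Y)
    (hlp : ∀ σ : K.Elements, σ.1.unop.len < x.1.unop.len → ¬ IsDegenerate σ →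
      HasLiftingProperty (latchingComparison σ Ψ) p) :
    HasLiftingProperty (bdryMap x Ψ) p := by
  have : HasColimit ((ObjectProperty.ι (fun g : Over x.1.unop =>
      ¬ Function.Surjective g.hom.toOrderHom) ⋙ toK x) ⋙ F) :=
    inferInstanceAs (HasColimit (bdryRestrict x F))
  have : HasColimit ((ObjectProperty.ι (fun g : Over x.1.unop =>
      ¬ Function.Surjective g.hom.toOrderHom) ⋙ toK x) ⋙ G) :=
    inferInstanceAs (HasColimit (bdryRestrict x G))
  refine core_colim hF hG (fibLike_bdry x) Ψ p ?_
  intro y σ q hσ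
  refine hlp σ.unop ?_ (nondeg_of q hσ)
  by_contra hlt
  exact hσ ((DK_of_not_surj (σ := op x) (toVertexHom x y.obj) y.property).mono (not_lt.1 hlt))

lemma latching_weq (ms : ModelStructure M) {F G : SimplexCat K ⥤ M} (hF : BoundedDiagram F)
    (hG : BoundedDiagram G) (Ψ : F ⟶ G) (hΨ : IsCofibrationOfDiagrams ms Ψ)
    (hw : ∀ x : SimplexCat K, ms.weq (Ψ.app x)) :
    ∀ (n : ℕ) (x : K.Elements), x.1.unop.len = n → ¬ IsDegenerate x →
      ms.weq (latchingComparison x Ψ) := by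
  intro n
  induction n using Nat.strong_induction_on with
  | _ n ih =>
    intro x hx hnd
    have h1 : ms.cof (pushout.inl (bdryToVertex x F) (bdryMap x Ψ)) ∧
        ms.weq (pushout.inl (bdryToVertex x F) (bdryMap x Ψ)) := by
      apply acof_of_llp
      intro X Y p hp
      have := bdry_llp hF hG Ψ x p (fun σ hσ hσn => ms.lifting_acyclicCof_fib _ _ (hΨ σ hσn)
        (ih _ (hx ▸ hσ) σ rfl hσn) hp)
      infer_instance
    refine ms.weq_of_comp_left _ _ h1.2 ?_
    have h2 : pushout.inl (bdryToVertex x F) (bdryMap x Ψ) ≫ latchingComparison x Ψ =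
      Ψ.app (op x) := pushout.inl_desc _ _ _
    rw [h2]
    exact hw _

lemma cofibrant_colim [HasInitial M] (ms : ModelStructure M) {L : SSet.{0}} (f : L ⟶ K)
    {F : SimplexCat K ⥤ M} (hF : BoundedDiagram F) (hc : CofibrantDiagram ms F) :
    ms.Cofibrant (colimit (simplexMap f ⋙ F)) := by
  let E : SimplexCat K ⥤ M := (Functor.const _).obj (⊥_ M)
  have hE : BoundedDiagram E := by
    intro x y e _
    exact inferInstanceAs (IsIso (𝟙 (⊥_ M)))
  let Ψ : E ⟶ F := { app := fun x => initial.to (F.obj x)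
                     naturality := fun _ _ _ => initialIsInitial.hom_ext _ _ }
  apply cof_of_llp
  intro X Y p hp hp'
  have key : HasLiftingProperty (colimMap (Functor.whiskerLeft (simplexMap f) Ψ)) p := by
    refine core_colim hE hF (fibLike_simplexMap f) Ψ p ?_
    intro y σ q hσ
    have := ms.lifting_cof_acyclicFib _ _ (hc σ.unop (nondeg_of q hσ)) hp hp'
    constructor
    intro u v sq
    have sq' : CommSq (pushout.inr _ _ ≫ u) (bdryToVertex σ.unop F) p v := by
      constructor
      rw [Category.assoc, sq.w, ← Category.assoc, latchingComparison, pushout.inr_desc]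
    refine ⟨⟨⟨sq'.lift, ?_, sq'.fac_right⟩⟩⟩
    apply pushout.hom_ext
    · exact initialIsInitial.hom_ext _ _
    · rw [← Category.assoc, latchingComparison, pushout.inr_desc, sq'.fac_left]
  constructor
  intro u v sq
  let c : Cocone (simplexMap f ⋙ E) :=
    { pt := X
      ι := { app := fun _ => initial.to X
             naturality := fun _ _ _ => initialIsInitial.hom_ext _ _ } }
  have sq' : CommSq (colimit.desc _ c) (colimMap (Functor.whiskerLeft (simplexMap f) Ψ)) p v := by
    constructor
    apply colimit.hom_ext
    intro y
    exact initialIsInitial.hom_ext _ _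
  exact ⟨⟨⟨sq'.lift, initialIsInitial.hom_ext _ _, sq'.fac_right⟩⟩⟩

end Model

end ColimPB

/-- Let `M` be a model category with all small colimits, `f : L ⟶ K`
a map of simplicial sets and `Ψ : F ⟶ G` a natural transformation between bounded
diagrams `𝐊 ⥤ M`.  If `Ψ` is a cofibration (resp. a cofibration which is an objectwise
weak equivalence), then `colim_𝐋 f*Ψ` is a cofibration (resp. an acyclic cofibration)
in `M`.  In particular if `F` is cofibrant then `colim_𝐋 f*F` and `colim_𝐊 F` are
cofibrant objects of `M`. -/
theorem colim_pullback_cofibration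
    {M : Type u} [Category.{v} M] [HasColimits M] [HasInitial M]
    (ms : ModelStructure M) {K L : SSet.{0}} (f : L ⟶ K)
    {F G : SimplexCat K ⥤ M} (hF : BoundedDiagram F) (hG : BoundedDiagram G)
    (Ψ : F ⟶ G) :
    (IsCofibrationOfDiagrams ms Ψ →
      ms.cof (colimMap (Functor.whiskerLeft (simplexMap f) Ψ))) ∧
    (IsCofibrationOfDiagrams ms Ψ → (∀ x : SimplexCat K, ms.weq (Ψ.app x)) →
      ms.cof (colimMap (Functor.whiskerLeft (simplexMap f) Ψ)) ∧
        ms.weq (colimMap (Functor.whiskerLeft (simplexMap f) Ψ))) ∧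
    (CofibrantDiagram ms F →
      ms.Cofibrant (colimit (simplexMap f ⋙ F)) ∧ ms.Cofibrant (colimit F)) := by
  refine ⟨?_, ?_, ?_⟩
  · intro hΨ
    apply ColimPB.cof_of_llp
    intro X Y p hp hp'
    exact ColimPB.core_colim hF hG (ColimPB.fibLike_simplexMap f) Ψ p fun y σ q hσ =>
      ms.lifting_cof_acyclicFib _ _ (hΨ σ.unop (ColimPB.nondeg_of q hσ)) hp hp'
  · intro hΨ hw
    apply ColimPB.acof_of_llp
    intro X Y p hp
    exact ColimPB.core_colim hF hG (ColimPB.fibLike_simplexMap f) Ψ p fun y σ q hσ =>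
      ms.lifting_acyclicCof_fib _ _ (hΨ σ.unop (ColimPB.nondeg_of q hσ))
        (ColimPB.latching_weq ms hF hG Ψ hΨ hw _ _ rfl (ColimPB.nondeg_of q hσ)) hp
  · intro hc
    refine ⟨ColimPB.cofibrant_colim ms f hF hc, ?_⟩
    exact ColimPB.cofibrant_colim ms (𝟙 K) hF hc
end
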